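/- arXiv:2507.06365 — 4 statements merged into one kernel-verified Lean document; each statement's English description precedes it below -/
import Mathlib

section
/- The Salvetti complex |Sal(A,K)| is weakly homotopy equivalent to the space Z(A,K): there is a space admitting weak homotopy equivalences to both |Sal(A,K)| and Z(A,K). -/
open scoped Topology.Homotopy

/-- The map induced on path components by a continuous map. -/
def pi0Map {X Y : Type*} [TopologicalSpace X] [TopologicalSpace Y] (g : C(X, Y)) :
    ZerothHomotopy X → ZerothHomotopy Y :=
  Quotient.map g (fun _ _ h => h.elim fun p => ⟨p.map g.continuous⟩)

/-- The map induced on homotopy groups by a continuous map. -/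
def piMap {X Y : Type*} [TopologicalSpace X] [TopologicalSpace Y] (n : ℕ) (g : C(X, Y)) (x : X) :
    HomotopyGroup (Fin n) X x → HomotopyGroup (Fin n) Y (g x) :=
  Quotient.map (fun p => ⟨g.comp p.1, fun y hy => by
      simp only [ContinuousMap.comp_apply, p.2 y hy]⟩)
    (fun p q h => h.elim fun H => ⟨H.compContinuousMap g⟩)

/-- A weak homotopy equivalence: a continuous map inducing a bijection on path components
and isomorphisms on all homotopy groups at every basepoint. -/
def IsWeakHomotopyEquiv {X Y : Type*} [TopologicalSpace X] [TopologicalSpace Y]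
    (g : C(X, Y)) : Prop :=
  Function.Bijective (pi0Map g) ∧
    ∀ (n : ℕ) (x : X), Function.Bijective (piMap n g x)

/-- Composition of sign vectors: `(X ∘ Y) e = X e` if `X e ≠ 0`, and `Y e` otherwise. -/
def scomp {E : Type*} (X Y : E → SignType) : E → SignType :=
  fun e => if X e = 0 then Y e else X e

/-- The partial order on sign vectors: `X ≤ Y` iff `X ∘ Y = Y`. -/
def sle {E : Type*} (X Y : E → SignType) : Prop := scomp X Y = Y

theorem sle_refl {E : Type*} (X : E → SignType) : sle X X := by
  funext e; show (if X e = 0 then X e else X e) = X e; split <;> rfl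

theorem sle_trans {E : Type*} {X Y Z : E → SignType} (h₁ : sle X Y) (h₂ : sle Y Z) :
    sle X Z := by
  funext e
  have h1 := congrFun h₁ e
  have h2 := congrFun h₂ e
  revert h1 h2
  show (if X e = 0 then Y e else X e) = Y e → (if Y e = 0 then Z e else Y e) = Z e →
    (if X e = 0 then Z e else X e) = Z e
  generalize X e = a; generalize Y e = b; generalize Z e = c
  revert a b c; decide

theorem sle_antisymm {E : Type*} {X Y : E → SignType} (h₁ : sle X Y) (h₂ : sle Y X) :
    X = Y := by
  funext e
  have h1 := congrFun h₁ e
  have h2 := congrFun h₂ e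
  revert h1 h2
  show (if X e = 0 then Y e else X e) = Y e → (if Y e = 0 then X e else Y e) = X e → X e = Y e
  generalize X e = a; generalize Y e = b
  revert a b; decide

/-- The separating set of two sign vectors: the indices where they take opposite
nonzero signs. -/
def SepSet {E : Type*} (X Y : E → SignType) : Set E :=
  {e | (X e = 1 ∧ Y e = -1) ∨ (X e = -1 ∧ Y e = 1)}

section Geometry

variable {E : Type*} {V : Type*} [NormedAddCommGroup V] [NormedSpace ℝ V]

/-- The face of a sign vector `X`, relative to the family of cooriented affine hyperplanes
`H_e = {v | f e v = 0}`, with positive side `H_e⁺ = {v | f e v > 0}` and negative side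
`H_e⁻ = {v | f e v < 0}`. -/
def face (f : E → (V →ᵃ[ℝ] ℝ)) (X : E → SignType) : Set V :=
  {v | ∀ e, SignType.sign (f e v) = X e}

/-- The conditional oriented matroid `L(A,K)`: the set of sign vectors whose face
meets `K`. -/
def covs (f : E → (V →ᵃ[ℝ] ℝ)) (K : Set V) : Set (E → SignType) :=
  {X | (face f X ∩ K).Nonempty}

/-- A tope of `L(A,K)`: a maximal covector. -/
def IsTope (f : E → (V →ᵃ[ℝ] ℝ)) (K : Set V) (T : E → SignType) : Prop :=
  T ∈ covs f K ∧ ∀ Y ∈ covs f K, sle T Y → Y = T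

/-- The set of topes of `L(A,K)`, as a type carrying the discrete topology. -/
def Topes (f : E → (V →ᵃ[ℝ] ℝ)) (K : Set V) : Type _ := {T : E → SignType // IsTope f K T}

instance (f : E → (V →ᵃ[ℝ] ℝ)) (K : Set V) : TopologicalSpace (Topes f K) := ⊥

instance (f : E → (V →ᵃ[ℝ] ℝ)) (K : Set V) : DiscreteTopology (Topes f K) := ⟨rfl⟩

/-- Points of `K × T(A,K)`. -/
abbrev ZPre (f : E → (V →ᵃ[ℝ] ℝ)) (K : Set V) : Type _ := K × Topes f K

/-- The gluing relation defining `Z(A,K)`: `(v,T) ∼ (v',T')` iff `v = v'` and `v` lies on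
no hyperplane separating `T` from `T'`. -/
def ZRel (f : E → (V →ᵃ[ℝ] ℝ)) (K : Set V) : ZPre f K → ZPre f K → Prop :=
  fun p q => (p.1 : V) = (q.1 : V) ∧ ∀ e ∈ SepSet p.2.1 q.2.1, f e (p.1 : V) ≠ 0

/-- The space `Z(A,K)`: one copy of `K` for each tope, glued along the complement of the
separating hyperplanes, with the quotient topology. -/
def ZSpace (f : E → (V →ᵃ[ℝ] ℝ)) (K : Set V) : Type _ := Quot (ZRel f K)

instance (f : E → (V →ᵃ[ℝ] ℝ)) (K : Set V) : TopologicalSpace (ZSpace f K) :=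
  inferInstanceAs (TopologicalSpace (Quot (ZRel f K)))

/-- The projection `π : Z(A,K) → V` (with image `K`), sending `[(v,T)]` to `v`. -/
def Zproj (f : E → (V →ᵃ[ℝ] ℝ)) (K : Set V) : ZSpace f K → V :=
  Quot.lift (fun p => (p.1 : V)) (fun _ _ h => h.1)

/-- The set `K_{X,T} = K ∩ ⋂_{e : X_e = 0} H_e^{T_e}`. -/
def KXT (f : E → (V →ᵃ[ℝ] ℝ)) (K : Set V) (X T : E → SignType) : Set V :=
  K ∩ ⋂ e ∈ {e | X e = 0}, {v | SignType.sign (f e v) = T e}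

/-- The subset `U_{X,T} ⊆ Z(A,K)`: the image of `K_{X,T} × {T}` under the quotient map. -/
def UXT (f : E → (V →ᵃ[ℝ] ℝ)) (K : Set V) (X : E → SignType) (T : Topes f K) :
    Set (ZSpace f K) :=
  {z | ∃ (v : V) (hv : v ∈ K), v ∈ KXT f K X T.1 ∧ z = Quot.mk (ZRel f K) (⟨v, hv⟩, T)}

/-- The complexified complement `M(A,K)`, where `V ⊗ ℂ` is modeled as `V × V` (real and
imaginary parts): `v + iw` lies on `H_e ⊗ ℂ` iff `f e v = 0` and the linear part of `f e`
vanishes on `w`. -/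
def MSpace (f : E → (V →ᵃ[ℝ] ℝ)) (K : Set V) : Type _ :=
  {p : V × V // p.1 ∈ K ∧ ∀ e, ¬(f e p.1 = 0 ∧ (f e).linear p.2 = 0)}

instance (f : E → (V →ᵃ[ℝ] ℝ)) (K : Set V) : TopologicalSpace (MSpace f K) :=
  inferInstanceAs (TopologicalSpace {p : V × V // p.1 ∈ K ∧ _})

/-- The projection `ρ : M(A,K) → V` (with image `K`), sending `v + iw` to `v`. -/
def Mproj (f : E → (V →ᵃ[ℝ] ℝ)) (K : Set V) : MSpace f K → V := fun p => p.1.1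

end Geometry

/-- The Salvetti poset `Sal(A,K)`: pairs `(X,T)` where `T` is a tope of `L(A,K)` and
`X ≤ T`. -/
@[ext]
structure SalP {E : Type*} {V : Type*} [NormedAddCommGroup V] [NormedSpace ℝ V]
    (f : E → (V →ᵃ[ℝ] ℝ)) (K : Set V) where
  X : E → SignType
  T : E → SignType
  memX : X ∈ covs f K
  topeT : IsTope f K T
  leXT : sle X T

/-- The partial order on the Salvetti poset: `(X,T) ⪯ (X',T')` iff `X ≤ X'` and
`X' ∘ T = T'`. -/
instance {E : Type*} {V : Type*} [NormedAddCommGroup V] [NormedSpace ℝ V]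
    (f : E → (V →ᵃ[ℝ] ℝ)) (K : Set V) : PartialOrder (SalP f K) where
  le p q := sle p.X q.X ∧ scomp q.X p.T = q.T
  le_refl p := ⟨sle_refl p.X, p.leXT⟩
  le_trans p q r h₁ h₂ := by
    refine ⟨sle_trans h₁.1 h₂.1, ?_⟩
    funext e
    have hc1 := congrFun h₁.2 e
    have hc2 := congrFun h₂.2 e
    have hc3 := congrFun h₂.1 e
    revert hc1 hc2 hc3
    show (if q.X e = 0 then p.T e else q.X e) = q.T e →
      (if r.X e = 0 then q.T e else r.X e) = r.T e →
      (if q.X e = 0 then r.X e else q.X e) = r.X e →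
      (if r.X e = 0 then p.T e else r.X e) = r.T e
    generalize q.X e = a; generalize p.T e = b; generalize q.T e = c
    generalize r.X e = d; generalize r.T e = g
    revert a b c d g; decide
  le_antisymm p q h₁ h₂ := by
    have hX : p.X = q.X := sle_antisymm h₁.1 h₂.1
    have hT : q.T = p.T := by rw [← h₁.2, hX.symm]; exact p.leXT
    ext1 <;> simp [hX, hT.symm]

open CategoryTheory in
/-- The order complex of a poset `P`: the geometric realization of the simplicial complex
whose simplices are the chains in `P` (implemented as the realization of the nerve of `P`,
which has the same homotopy type). -/
noncomputable def orderComplex (P : Type) [PartialOrder P] : TopCat :=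
  SSet.toTop.obj (CategoryTheory.nerve P)

namespace RealizationPoints

open CategoryTheory Simplicial Opposite

/-- The characteristic map of an `n`-simplex into the geometric realization. -/
noncomputable def charMap (X : SSet.{0}) {n : SimplexCategory} (x : X.obj (op n)) :
    C(stdSimplex ℝ (Fin (n.len + 1)), |X|) :=
  (SSet.toTop.map (SSet.yonedaEquiv.symm x)).hom.comp
    ⟨n.toTopHomeo.symm, n.toTopHomeo.symm.continuous⟩

lemma charMap_map (X : SSet.{0}) {n m : SimplexCategory} (f : n ⟶ m) (x : X.obj (op m))
    (t : stdSimplex ℝ (Fin (n.len + 1))) :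
    charMap X (X.map f.op x) t = charMap X x (stdSimplex.map f t) := by
  have h : SSet.yonedaEquiv.symm (X.map f.op x) =
      SSet.stdSimplex.map f ≫ SSet.yonedaEquiv.symm x := by
    apply SSet.yonedaEquiv.injective
    rw [SSet.yonedaEquiv_comp, SSet.yonedaEquiv_map]
    exact (SSet.yonedaEquiv.apply_symm_apply (X.map f.op x)).trans rfl
  simp only [charMap, ContinuousMap.comp_apply, ContinuousMap.coe_mk,
    SimplexCategory.toTopHomeo_symm_naturality_apply, h, Functor.map_comp]
  rfl

lemma toSSetObjEquiv_homEquiv (X : SSet.{0}) (Y : TopCat.{0}) (g : |X| ⟶ Y) {n : SimplexCategory}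
    (x : X.obj (op n)) (t : stdSimplex ℝ (Fin (n.len + 1))) :
    Y.toSSetObjEquiv (op n) ((sSetTopAdj.homEquiv X Y g).app (op n) x) t = g (charMap X x t) := by
  rw [Adjunction.homEquiv_unit]
  have := sSetTopAdj_unit_app_app_down X (op n) x
  have h2 := ConcreteCategory.congr_hom this (ULift.up t)
  exact congrArg g h2

lemma exists_charMap_eq (X : SSet.{0}) (y : |X|) :
    ∃ (n : SimplexCategory) (x : X.obj (op n)) (t : stdSimplex ℝ (Fin (n.len + 1))),
      charMap X x t = y := by
  classical
  let S : Set |X| := {y | ∃ (n : SimplexCategory) (x : X.obj (op n))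
    (t : stdSimplex ℝ (Fin (n.len + 1))), charMap X x t = y}
  let _ : TopologicalSpace Bool := ⊤
  let Y : TopCat.{0} := @TopCat.of Bool ⊤
  let g₁ : |X| ⟶ Y := @TopCat.ofHom _ _ _ ⊤
    (@ContinuousMap.mk _ _ _ ⊤ (fun y => decide (y ∈ S)) continuous_top)
  let g₂ : |X| ⟶ Y := @TopCat.ofHom _ _ _ ⊤
    (@ContinuousMap.mk _ _ _ ⊤ (fun y => true) continuous_top)
  have h : g₁ = g₂ := by
    apply (sSetTopAdj.homEquiv X Y).injective
    ext ⟨n⟩ x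
    apply (Y.toSSetObjEquiv (op n)).injective
    ext t
    refine (toSSetObjEquiv_homEquiv X Y g₁ x t).trans
      (Eq.trans ?_ (toSSetObjEquiv_homEquiv X Y g₂ x t).symm)
    exact decide_eq_true ⟨n, x, t, rfl⟩
  have h1 : g₁ y = true := by rw [h]; rfl
  exact of_decide_eq_true h1

lemma exists_desc (X : SSet.{0}) (Y : TopCat.{0})
    (φ : ∀ (n : SimplexCategory), X.obj (op n) → C(stdSimplex ℝ (Fin (n.len + 1)), Y))
    (hφ : ∀ {n m : SimplexCategory} (f : n ⟶ m) (x : X.obj (op m)) t,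
      φ n (X.map f.op x) t = φ m x (stdSimplex.map f t)) :
    ∃ g : |X| ⟶ Y, ∀ (n : SimplexCategory) (x : X.obj (op n)) t, g (charMap X x t) = φ n x t := by
  let F : X ⟶ TopCat.toSSet.obj Y :=
    { app := fun n => ↾fun x => (Y.toSSetObjEquiv n).symm (φ n.unop x)
      naturality := by
        rintro ⟨m⟩ ⟨n⟩ ⟨f⟩
        ext x
        apply (Y.toSSetObjEquiv (op n)).injective
        ext t
        exact hφ f x t }
  refine ⟨(sSetTopAdj.homEquiv X Y).symm F, fun n x t => ?_⟩
  rw [← toSSetObjEquiv_homEquiv, Equiv.apply_symm_apply]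
  exact congrFun (congrArg DFunLike.coe ((Y.toSSetObjEquiv (op n)).apply_symm_apply (φ n x))) t

end RealizationPoints

namespace stdSimplex

variable {X Y : Type*} [Fintype X] [Fintype Y]

lemma map_apply_eq_sum [DecidableEq Y] (f : X → Y) (s : stdSimplex ℝ X) (y : Y) :
    map f s y = ∑ x with f x = y, s x := by
  rw [map_coe, FunOnFinite.linearMap_apply_apply]

lemma map_apply_of_injective {f : X → Y} (hf : f.Injective) (s : stdSimplex ℝ X) (x : X) :
    map f s (f x) = s x := by
  classical
  rw [map_apply_eq_sum, Finset.sum_eq_single x] <;> simp +contextual [hf.eq_iff]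

lemma map_injective {f : X → Y} (hf : f.Injective) : (map (S := ℝ) f).Injective := by
  intro s t h
  ext x
  rw [← map_apply_of_injective hf, h, map_apply_of_injective hf]

lemma exists_apply_ne_zero_of_map {f : X → Y} {s : stdSimplex ℝ X} {y : Y} (h : map f s y ≠ 0) :
    ∃ x, f x = y ∧ s x ≠ 0 := by
  classical
  rw [map_apply_eq_sum] at h
  obtain ⟨x, hx, hx'⟩ := Finset.exists_ne_zero_of_sum_ne_zero h
  exact ⟨x, by simpa using hx, hx'⟩

lemma map_apply_ne_zero {f : X → Y} {s : stdSimplex ℝ X} {x : X} (h : s x ≠ 0) :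
    map f s (f x) ≠ 0 := by
  classical
  rw [map_apply_eq_sum]
  refine (Finset.sum_pos' (fun _ _ => s.2.1 _) ⟨x, by simp, ?_⟩).ne'
  exact lt_of_le_of_ne (s.2.1 x) h.symm

lemma exists_map_eq {f : X → Y} (hf : f.Injective) (t : stdSimplex ℝ Y)
    (ht : ∀ y, t y ≠ 0 → y ∈ Set.range f) : ∃ s, map f s = t := by
  classical
  refine ⟨⟨fun x => t (f x), fun x => t.2.1 _, ?_⟩, ?_⟩
  · rw [← t.2.2]
    exact Fintype.sum_of_injective f hf _ _ (fun y hy => by_contra fun h => hy (ht y h))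
      fun _ => rfl
  · ext y
    by_cases hy : y ∈ Set.range f
    · obtain ⟨x, rfl⟩ := hy
      exact map_apply_of_injective hf _ x
    · rw [not_ne_iff.1 (fun h => hy (ht y h))]
      by_contra h
      obtain ⟨x, rfl, -⟩ := exists_apply_ne_zero_of_map h
      exact hy ⟨x, rfl⟩

lemma exists_ne_zero (s : stdSimplex ℝ X) : ∃ x, s x ≠ 0 := by
  by_contra! h
  have := s.2.2
  simp only [show ∀ x, s.1 x = 0 from h, Finset.sum_const_zero] at this
  exact zero_ne_one this

end stdSimplex

/-- The points of the standard simplex on a finite poset `P` whose support is a chain. -/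
def chainComplex (P : Type*) [Fintype P] [PartialOrder P] : Set (stdSimplex ℝ P) :=
  {x | ∀ p q, x p ≠ 0 → x q ≠ 0 → p ≤ q ∨ q ≤ p}

namespace chainComplex

open RealizationPoints stdSimplex CategoryTheory Simplicial Opposite

section

variable {P : Type} [PartialOrder P]

/-- The simplex of the nerve given by a monotone map. -/
abbrev simplex {n : SimplexCategory} (a : Fin (n.len + 1) →o P) : (nerve P).obj (op n) :=
  a.monotone.functor

/-- The monotone map underlying a simplex of the nerve. -/
def vertices {n : SimplexCategory} (F : (nerve P).obj (op n)) : Fin (n.len + 1) →o P where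
  toFun := (show Fin (n.len + 1) ⥤ P from F).obj
  monotone' _ _ h := leOfHom ((show Fin (n.len + 1) ⥤ P from F).map (homOfLE h))

lemma exists_simplex_eq {n : SimplexCategory} (F : (nerve P).obj (op n)) :
    ∃ a, simplex a = F :=
  ⟨vertices F, rfl⟩

lemma charMap_comp {n m : SimplexCategory} (a : Fin (m.len + 1) →o P)
    (b : Fin (n.len + 1) →o Fin (m.len + 1)) (t : stdSimplex ℝ (Fin (n.len + 1))) :
    charMap (nerve P) (simplex (a.comp b)) t = charMap (nerve P) (simplex a) (map b t) :=
  charMap_map (nerve P) (SimplexCategory.Hom.mk b) (simplex a) t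

end

variable {P : Type} [Fintype P] [PartialOrder P]

lemma map_mem {n : ℕ} (a : Fin n →o P) (t : stdSimplex ℝ (Fin n)) :
    map a t ∈ chainComplex P := by
  intro p q hp hq
  obtain ⟨i, rfl, -⟩ := exists_apply_ne_zero_of_map hp
  obtain ⟨j, rfl, -⟩ := exists_apply_ne_zero_of_map hq
  exact (le_total i j).imp (fun h => a.monotone h) (fun h => a.monotone h)

/-- The point of the chain complex with given coordinates in a simplex of the nerve. -/
noncomputable def chart {n : SimplexCategory} (F : (nerve P).obj (op n)) :
    C(stdSimplex ℝ (Fin (n.len + 1)), chainComplex P) where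
  toFun t := ⟨map (vertices F) t, map_mem _ _⟩
  continuous_toFun := (continuous_map _).subtype_mk _

lemma chart_map {n m : SimplexCategory} (f : n ⟶ m) (F : (nerve P).obj (op m))
    (t : stdSimplex ℝ (Fin (n.len + 1))) :
    chart ((nerve P).map f.op F) t = chart F (map f t) :=
  Subtype.ext (map_comp_apply (X := Fin (n.len + 1)) (Y := Fin (m.len + 1)) f (vertices F) t).symm

lemma exists_desc_map (P : Type) [Fintype P] [PartialOrder P] :
    ∃ g : C(orderComplex P, chainComplex P), ∀ (n : SimplexCategory)
    (a : Fin (n.len + 1) →o P) t, (g (charMap (nerve P) (simplex a) t)).1 = map a t := by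
  obtain ⟨g, hg⟩ := exists_desc (nerve P) (TopCat.of (chainComplex P))
    (fun n F => chart F) chart_map
  exact ⟨g.hom, fun n a t => congrArg Subtype.val (hg n (simplex a) t)⟩

/-- Every point of the chain complex has a canonical chart. -/
lemma exists_chart (x : stdSimplex ℝ P) (hx : x ∈ chainComplex P) :
    ∃ (n : SimplexCategory) (e : Fin (n.len + 1) →o P), n.len < Fintype.card P ∧
      Function.Injective e ∧ (∃ s, map e s = x) ∧
      ∀ (m : SimplexCategory) (a : Fin (m.len + 1) →o P) (t : stdSimplex ℝ (Fin (m.len + 1))),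
        map a t = x → ∃ s, charMap (nerve P) (simplex a) t = charMap (nerve P) (simplex e) s := by
  classical
  let C := {p : P // x p ≠ 0}
  let _ : LinearOrder C :=
    { (inferInstance : PartialOrder C) with
      le_total := fun p q => hx p q p.2 q.2
      toDecidableLE := Classical.decRel _ }
  obtain ⟨p₀, hp₀⟩ := exists_ne_zero x
  obtain ⟨n, hn⟩ := Nat.exists_eq_succ_of_ne_zero
    (Fintype.card_pos_iff.2 (⟨⟨p₀, hp₀⟩⟩ : Nonempty C)).ne'
  let o : Fin (n + 1) ≃o C := monoEquivOfFin C hn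
  let e : Fin (n + 1) →o P := ⟨fun i => (o i).1, fun i j h => o.monotone h⟩
  have he : Function.Injective e := fun i j h => o.injective (Subtype.ext h)
  refine ⟨.mk n, e, ?_, he, exists_map_eq he x fun y hy => ⟨o.symm ⟨y, hy⟩, ?_⟩, fun m a t h => ?_⟩
  · exact Nat.lt_of_succ_le (hn.symm.trans_le (Fintype.card_subtype_le _))
  · exact congrArg Subtype.val (o.apply_symm_apply ⟨y, hy⟩)
  · let S : Finset (Fin (m.len + 1)) := {i | t i ≠ 0}
    obtain ⟨i₀, hi₀⟩ := exists_ne_zero t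
    have hS : S.card ≠ 0 := Finset.card_ne_zero_of_mem (a := i₀) (by simpa [S] using hi₀)
    obtain ⟨k, hk⟩ := Nat.exists_eq_succ_of_ne_zero hS
    let d : Fin (k + 1) ↪o Fin (m.len + 1) := S.orderEmbOfFin hk
    have hd : ∀ i, t i ≠ 0 ↔ i ∈ Set.range d := by
      intro i
      rw [Finset.range_orderEmbOfFin]
      simp [S]
    obtain ⟨s, hs⟩ := exists_map_eq d.injective t fun i => (hd i).1
    have had : ∀ i, x (a (d i)) ≠ 0 := fun i => by
      rw [← h]; exact map_apply_ne_zero ((hd _).2 ⟨i, rfl⟩)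
    let q : Fin (k + 1) →o Fin (n + 1) :=
      ⟨fun i => o.symm ⟨a (d i), had i⟩, fun i j hij => o.symm.monotone
        (show a (d i) ≤ a (d j) from a.monotone (d.monotone hij))⟩
    have hq : e.comp q = a.comp d.toOrderHom := by
      ext i
      exact congrArg Subtype.val (o.apply_symm_apply ⟨a (d i), had i⟩)
    refine ⟨map q s, ?_⟩
    rw [← charMap_comp (n := .mk k) (m := .mk n) e q s, hq]
    exact hs ▸ (charMap_comp (n := .mk k) a d.toOrderHom s).symm

instance : CompactSpace (orderComplex P) := by
  obtain ⟨g, hg⟩ := exists_desc_map P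
  have h : (Set.univ : Set (orderComplex P)) = ⋃ p : Σ m : Fin (Fintype.card P), Fin (m + 1) →o P,
      Set.range (charMap (nerve P) (n := .mk p.1) (simplex (n := .mk p.1) p.2)) := by
    refine (Set.eq_univ_of_forall fun y => ?_).symm
    obtain ⟨n, F, t, rfl⟩ := exists_charMap_eq _ y
    obtain ⟨a, rfl⟩ := exists_simplex_eq F
    obtain ⟨m, e, hm, -, -, hc⟩ := exists_chart _ (g (charMap (nerve P) (simplex a) t)).2
    obtain ⟨s, hs⟩ := hc n a t (hg n a t).symm
    exact Set.mem_iUnion.2 ⟨⟨⟨m.len, hm⟩, e⟩, s, hs.symm⟩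
  have (m : ℕ) : Finite (Fin m →o P) := DFunLike.finite _
  exact ⟨h ▸ isCompact_iUnion fun p => isCompact_range (ContinuousMap.continuous _)⟩

lemma exists_homeomorph (P : Type) [Fintype P] [PartialOrder P] :
    Nonempty (chainComplex P ≃ₜ orderComplex P) := by
  obtain ⟨g, hg⟩ := exists_desc_map P
  have : IsHomeomorph g := by
    rw [isHomeomorph_iff_continuous_bijective]
    refine ⟨g.continuous, fun y y' h => ?_, fun x => ?_⟩
    · obtain ⟨n, F, t, rfl⟩ := exists_charMap_eq _ y
      obtain ⟨n', F', t', rfl⟩ := exists_charMap_eq _ y'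
      obtain ⟨a, rfl⟩ := exists_simplex_eq F
      obtain ⟨a', rfl⟩ := exists_simplex_eq F'
      obtain ⟨m, e, -, he, -, hc⟩ := exists_chart _ (g (charMap (nerve P) (simplex a) t)).2
      obtain ⟨s, hs⟩ := hc n a t (hg n a t).symm
      obtain ⟨s', hs'⟩ := hc n' a' t' (by rw [h, hg])
      rw [hs, hs'] at h ⊢
      have := congrArg Subtype.val h
      rw [hg, hg] at this
      rw [stdSimplex.map_injective he this]
    · obtain ⟨n, e, -, -, ⟨s, hs⟩, -⟩ := exists_chart x.1 x.2
      exact ⟨charMap (nerve P) (simplex e) s, Subtype.ext ((hg _ _ _).trans hs)⟩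
  exact ⟨this.homeomorph.symm⟩

end chainComplex

open scoped unitInterval in
/-- A map along which extension problems over closed subsets of normal spaces
can be solved up to relative homotopy is a weak homotopy equivalence. -/
theorem IsWeakHomotopyEquiv.of_lifting {X Y : Type} [TopologicalSpace X] [TopologicalSpace Y]
    (g : C(X, Y))
    (hg : ∀ (B : Type) [TopologicalSpace B] [NormalSpace B] (A : Set B), IsClosed A →
      ∀ (φ : C(B, Y)) (ψ : C(A, X)), (∀ a, g (ψ a) = φ a) →
        ∃ Ψ : C(B, X), (∀ a : A, Ψ a = ψ a) ∧ (g.comp Ψ).HomotopicRel φ A) :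
    IsWeakHomotopyEquiv g := by
  have hbd (n : ℕ) : IsClosed (Cube.boundary (Fin n)) := by
    have : Cube.boundary (Fin n) = ⋃ i, {y | y i = 0 ∨ y i = 1} := by
      ext y; simp [Cube.boundary]
    rw [this]
    exact isClosed_iUnion_of_finite fun i =>
      (isClosed_eq (continuous_apply i) continuous_const).union
        (isClosed_eq (continuous_apply i) continuous_const)
  refine ⟨⟨?_, ?_⟩, fun n x => ⟨?_, ?_⟩⟩
  · rintro ⟨x⟩ ⟨x'⟩ h
    obtain ⟨p⟩ : Joined (g x) (g x') := Quotient.exact h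
    classical
    obtain ⟨Ψ, hΨ, -⟩ := hg I {0, 1} (Set.toFinite _).isClosed p.toContinuousMap
      ⟨fun a => if a.1 = 0 then x else x', continuous_of_discreteTopology⟩ (by
        rintro ⟨a, rfl | rfl⟩ <;> simp)
    refine Quotient.sound ⟨⟨Ψ, ?_, ?_⟩⟩
    · simpa using hΨ ⟨0, by simp⟩
    · simpa using hΨ ⟨1, by simp⟩
  · rintro ⟨y⟩
    obtain ⟨Ψ, -, ⟨H⟩⟩ := hg Unit ∅ isClosed_empty (.const _ y) ⟨fun a => a.2.elim, by
      exact continuous_of_discreteTopology⟩ (fun a => a.2.elim)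
    exact ⟨Quotient.mk _ (Ψ ()), Quotient.sound ⟨H.toHomotopy.evalAt ()⟩⟩
  · rintro ⟨p⟩ ⟨q⟩ h
    obtain ⟨H⟩ := Quotient.exact h
    let A : Set (I × (Fin n → I)) := {b | b.1 = 0 ∨ b.1 = 1 ∨ b.2 ∈ Cube.boundary (Fin n)}
    have hA : IsClosed A := (isClosed_eq continuous_fst continuous_const).union
      ((isClosed_eq continuous_fst continuous_const).union ((hbd n).preimage continuous_snd))
    have h0 : (0 : I) ≠ ⟨1 / 2, by norm_num, by norm_num⟩ := fun h => by
      have := congrArg Subtype.val h; norm_num at this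
    have h1 : (1 : I) ≠ ⟨1 / 2, by norm_num, by norm_num⟩ := fun h => by
      have := congrArg Subtype.val h; norm_num at this
    have h1' : ¬ (1 : I) ≤ ⟨1 / 2, by norm_num, by norm_num⟩ := fun h => by
      have : (1 : ℝ) ≤ 1 / 2 := h
      norm_num at this
    obtain ⟨Ψ, hΨ, -⟩ := hg _ A hA H.toContinuousMap
      ⟨fun a => if a.1.1 ≤ ⟨1 / 2, by norm_num, by norm_num⟩ then p a.1.2 else q a.1.2, by
        refine Continuous.if_le (by fun_prop) (by fun_prop) (by fun_prop) (by fun_prop) ?_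
        rintro ⟨⟨t, y⟩, ht | ht | hy⟩ h
        · exact (h0 (ht.symm.trans h)).elim
        · exact (h1 (ht.symm.trans h)).elim
        · exact (p.2 y hy).trans (q.2 y hy).symm⟩ (by
        rintro ⟨⟨t, y⟩, ht⟩
        simp only [ContinuousMap.coe_mk]
        rcases ht with rfl | rfl | hy
        · rw [if_pos unitInterval.nonneg']
          exact (H.apply_zero y).symm
        · rw [if_neg h1']
          exact (H.apply_one y).symm
        · have : H (t, y) = g x := (H.eq_fst t hy).trans (congrArg g (p.2 y hy))
          refine Eq.trans ?_ this.symm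
          have hp : p y = x := p.2 y hy
          have hq : q y = x := q.2 y hy
          split_ifs
          · rw [hp]
          · rw [hq])
    refine Quotient.sound ⟨⟨⟨Ψ, fun y => ?_, fun y => ?_⟩, fun t y hy => ?_⟩⟩
    · refine (hΨ ⟨(0, y), Or.inl rfl⟩).trans ?_
      exact if_pos unitInterval.nonneg'
    · refine (hΨ ⟨(1, y), Or.inr (Or.inl rfl)⟩).trans ?_
      exact if_neg h1'
    · refine (hΨ ⟨(t, y), Or.inr (Or.inr hy)⟩).trans ?_
      have hp : p y = x := p.2 y hy
      have hq : q y = x := q.2 y hy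
      change (if _ then p y else q y) = p y
      rw [hp, hq, ite_self]
  · rintro ⟨p⟩
    obtain ⟨Ψ, hΨ, H⟩ := hg _ _ (hbd n) p.1 (.const _ x) (fun a => (p.2 a a.2).symm)
    exact ⟨Quotient.mk _ ⟨Ψ, fun y hy => hΨ ⟨y, hy⟩⟩, Quotient.sound H⟩

theorem IsWeakHomotopyEquiv.of_homeomorph {X Y : Type} [TopologicalSpace X] [TopologicalSpace Y]
    (e : X ≃ₜ Y) : IsWeakHomotopyEquiv (e : C(X, Y)) := by
  refine .of_lifting _ fun B _ _ A hA φ ψ h =>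
    ⟨(e.symm : C(Y, X)).comp φ, fun a => ?_, ?_⟩
  · exact (congrArg e.symm (h a)).symm.trans (e.symm_apply_apply _)
  · convert ContinuousMap.HomotopicRel.refl φ
    ext b
    exact e.apply_symm_apply _

section ChainLift

variable {B P : Type} [TopologicalSpace B] [NormalSpace B] [Fintype P] [PartialOrder P]

/-- The points of the chain complex whose support is bounded above by `m`. -/
def chainComplexIic (m : P) : Set (P → ℝ) :=
  {x | (x ∈ stdSimplex ℝ P ∧ ∀ p q, x p ≠ 0 → x q ≠ 0 → p ≤ q ∨ q ≤ p) ∧ ∀ p, x p ≠ 0 → p ≤ m}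

lemma chainComplexIic_mono {m m' : P} (h : m ≤ m') :
    chainComplexIic m ⊆ chainComplexIic m' :=
  fun _ hx => ⟨hx.1, fun p hp => (hx.2 p hp).trans h⟩

/-- The cone `chainComplexIic m` is an absolute extensor for normal spaces. -/
lemma exists_extension_chainComplexIic (m : P) {D : Set B} (hD : IsClosed D)
    {u : B → P → ℝ} (hu : ContinuousOn u D) (hm : ∀ b ∈ D, u b ∈ chainComplexIic m) :
    ∃ v : B → P → ℝ, Continuous v ∧ (∀ b, v b ∈ chainComplexIic m) ∧ Set.EqOn v u D := by
  classical
  have hext : ∀ q, ∃ f : C(B, ℝ), ∀ b ∈ D, f b = u b q := fun q => by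
    obtain ⟨f, hf⟩ := ContinuousMap.exists_restrict_eq hD
      ⟨D.domRestrict fun b => u b q, ((continuousOn_pi.1 hu) q).domRestrict⟩
    exact ⟨f, fun b hb => congrArg (fun k : C(D, ℝ) => k ⟨b, hb⟩) hf⟩
  choose f hf using hext
  let w : B → P → ℝ := fun b q => if q < m then max 0 (f q b) else 0
  let r : B → P → ℝ := fun b q => max 0 (w b q - ∑ p with ¬ (p ≤ q ∨ q ≤ p), w b p)
  let s : B → P → ℝ := fun b q => r b q / max 1 (∑ p, r b p)
  let v : B → P → ℝ := fun b q => s b q + if q = m then 1 - ∑ p, s b p else 0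
  have hw0 (b q) : 0 ≤ w b q := by dsimp only [w]; split_ifs <;> simp
  have hr0 (b q) : 0 ≤ r b q := le_max_left _ _
  have hpos (b) : 0 < max 1 (∑ p, r b p) := lt_of_lt_of_le one_pos (le_max_left _ _)
  have hs0 (b q) : 0 ≤ s b q := div_nonneg (hr0 b q) (hpos b).le
  have hs1 (b) : ∑ p, s b p ≤ 1 := by
    rw [← Finset.sum_div]
    exact (div_le_one (hpos b)).2 (le_max_right _ _)
  have hrw {b q} (h : r b q ≠ 0) : ∑ p with ¬ (p ≤ q ∨ q ≤ p), w b p < w b q := by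
    by_contra h'
    exact h (max_eq_left (sub_nonpos.2 (not_lt.1 h')))
  have hrlt {b q} (h : r b q ≠ 0) : q < m := by
    by_contra h'
    have h1 := hrw h
    have h2 : w b q = 0 := if_neg h'
    exact absurd (Finset.sum_nonneg fun p _ => hw0 b p) (by rw [h2] at h1; exact h1.not_ge)
  have hrcomp {b p q} (hp : r b p ≠ 0) (hq : r b q ≠ 0) : p ≤ q ∨ q ≤ p := by
    by_contra h
    have h1 : w b p ≤ ∑ p with ¬ (p ≤ q ∨ q ≤ p), w b p :=
      Finset.single_le_sum (fun p _ => hw0 b p) (by simpa using h)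
    have h2 : w b q ≤ ∑ q with ¬ (q ≤ p ∨ p ≤ q), w b q :=
      Finset.single_le_sum (fun p _ => hw0 b p) (by simpa [and_comm] using h)
    linarith [hrw hp, hrw hq]
  have hvr {b q} (h : v b q ≠ 0) : r b q ≠ 0 ∨ q = m := by
    by_contra! h'
    exact h (by simp [v, s, h'.1, h'.2])
  refine ⟨v, ?_, fun b => ⟨⟨⟨fun q => ?_, ?_⟩, fun p q hp hq => ?_⟩, fun p hp => ?_⟩,
    fun b hb => ?_⟩
  · have hwc (q) : Continuous fun b => w b q := by
      dsimp only [w]; split_ifs <;> fun_prop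
    have hrc (q) : Continuous fun b => r b q := by
      dsimp only [r]; fun_prop
    have hsc (q) : Continuous fun b => s b q :=
      (hrc q).div (by fun_prop) fun b => (hpos b).ne'
    refine continuous_pi fun q => (hsc q).add ?_
    split_ifs <;> fun_prop
  · have := hs1 b
    have := hs0 b q
    dsimp only [v]
    split_ifs <;> linarith
  · simp [v, Finset.sum_add_distrib]
  · rcases hvr hp with hp | rfl <;> rcases hvr hq with hq | rfl
    · exact hrcomp hp hq
    · exact .inl (hrlt hp).le
    · exact .inr (hrlt hq).le
    · exact .inl le_rfl
  · rcases hvr hp with hp | rfl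
    exacts [(hrlt hp).le, le_rfl]
  · obtain ⟨⟨⟨hu0, hu1⟩, huc⟩, hum⟩ := hm b hb
    have hwu (q) : w b q = if q = m then 0 else u b q := by
      by_cases hq : q < m
      · simp [w, hq, hq.ne, hf q b hb, hu0 q]
      · by_cases hqm : q = m
        · simp [w, hqm]
        · have : u b q = 0 := by_contra fun h => hq (lt_of_le_of_ne (hum q h) hqm)
          simp [w, hq, this]
    have hru (q) : r b q = if q = m then 0 else u b q := by
      by_cases hq : w b q = 0
      · rw [← hwu, hq]
        simp only [r, hq, zero_sub]
        exact max_eq_left (neg_nonpos.2 (Finset.sum_nonneg fun p _ => hw0 b p))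
      · have : ∑ p with ¬ (p ≤ q ∨ q ≤ p), w b p = 0 := by
          refine Finset.sum_eq_zero fun p hp => ?_
          by_contra hp'
          rw [hwu] at hp' hq
          refine (Finset.mem_filter.1 hp).2 (huc p q ?_ ?_)
          · exact fun h => hp' (by simp [h])
          · exact fun h => hq (by simp [h])
        simp only [r, this, sub_zero]
        rw [max_eq_right (hw0 b q), hwu]
    have hsum : ∑ p, r b p = 1 - u b m := by
      have : ∀ p, r b p = u b p - if p = m then u b m else 0 := fun p => by
        rw [hru]; split_ifs with h <;> simp [h]
      simp [this, hu1]
    have hsr (q) : s b q = r b q := by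
      dsimp only [s]
      rw [hsum, max_eq_left (by linarith [hu0 m]), div_one]
    ext q
    simp only [v, hsr, hsum]
    rw [hru]
    split_ifs with h <;> simp [h]

/-- A map to a finite poset lifts to the chain complex, extending a prescribed lift. -/
theorem exists_chainComplex_lift (c : B → P) (hc : ∀ p, IsOpen {b | p ≤ c b}) {A : Set B}
    (hA : IsClosed A) (ψ : C(A, chainComplex P)) (hψ : ∀ a p, (ψ a).1 p ≠ 0 → p ≤ c a) :
    ∃ Ψ : C(B, chainComplex P), (∀ a : A, Ψ a = ψ a) ∧ ∀ b p, (Ψ b).1 p ≠ 0 → p ≤ c b := by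
  classical
  have hclosed (L : Finset P) (hL : IsLowerSet (L : Set P)) : IsClosed {b | c b ∈ L} := by
    have : {b | c b ∈ L}ᶜ = ⋃ p ∈ (L : Set P)ᶜ, {b | p ≤ c b} := by
      ext b
      simp only [Set.mem_compl_iff, Set.mem_ofPred_eq, Set.mem_iUnion, exists_prop]
      exact ⟨fun h => ⟨c b, h, le_rfl⟩, fun ⟨p, hp, hpb⟩ h => hp (hL hpb h)⟩
    exact isOpen_compl_iff.1 (this ▸ isOpen_biUnion fun p _ => hc p)
  let u₀ : B → P → ℝ := fun b => if h : b ∈ A then (ψ ⟨b, h⟩).1.1 else 0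
  have hu₀ (a : A) : u₀ a = (ψ a).1.1 := dif_pos a.2
  have key : ∀ (k : ℕ) (L : Finset P), L.card = k → IsLowerSet (L : Set P) →
      ∃ u : B → P → ℝ, ContinuousOn u (A ∪ {b | c b ∈ L}) ∧
        (∀ b ∈ A ∪ {b | c b ∈ L}, u b ∈ chainComplexIic (c b)) ∧ Set.EqOn u u₀ A := by
    intro k
    induction k with
    | zero =>
      intro L hL _
      obtain rfl := Finset.card_eq_zero.1 hL
      refine ⟨u₀, ?_, ?_, fun _ _ => rfl⟩
      · simp only [Finset.notMem_empty, Set.ofPred_false, Set.union_empty]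
        rw [continuousOn_iff_continuous_domRestrict]
        exact ((continuous_subtype_val.comp continuous_subtype_val).comp ψ.continuous).congr
          fun a => (hu₀ a).symm
      · rintro b (hb | hb)
        · rw [hu₀ ⟨b, hb⟩]
          exact ⟨⟨(ψ ⟨b, hb⟩).1.2, (ψ ⟨b, hb⟩).2⟩, hψ ⟨b, hb⟩⟩
        · simp at hb
    | succ k ih =>
      intro L hL hlow
      obtain ⟨m, hm⟩ := L.exists_maximal (Finset.card_pos.1 (hL ▸ k.succ_pos))
      have hlow' : IsLowerSet (L.erase m : Set P) := by
        intro p q hqp hp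
        have hp' := Finset.mem_erase.1 (Finset.mem_coe.1 hp)
        refine Finset.mem_coe.2 (Finset.mem_erase.2 ⟨?_, hlow hqp hp'.2⟩)
        rintro rfl
        exact hp'.1 (le_antisymm (hm.2 hp'.2 hqp) hqp)
      obtain ⟨u, huc, hu, huA⟩ := ih (L.erase m) (by rw [Finset.card_erase_of_mem hm.1, hL]; rfl)
        hlow'
      set D := A ∪ {b | c b ∈ L.erase m} with hD
      have hDc : IsClosed D := hA.union (hclosed _ hlow')
      let G := {b | c b ≤ m}
      have hGc : IsClosed G := by
        have := hclosed (Finset.univ.filter (· ≤ m)) (by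
          intro p q hqp hp; simp at hp ⊢; exact hqp.trans hp)
        simpa using this
      obtain ⟨v, hvc, hv, hvu⟩ := exists_extension_chainComplexIic m (hDc.inter hGc)
        (huc.mono Set.inter_subset_left)
        (fun b hb => chainComplexIic_mono hb.2 (hu b hb.1))
      have hsub : A ∪ {b | c b ∈ L} ⊆ D ∪ G := by
        rintro b (hb | hb)
        · exact .inl (.inl hb)
        · by_cases h : c b = m
          · exact .inr h.le
          · exact .inl (.inr (Finset.mem_erase.2 ⟨h, hb⟩))
      let w : B → P → ℝ := fun b => if b ∈ D then u b else v b
      have hwD : Set.EqOn w u D := fun b hb => if_pos hb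
      have hwG : Set.EqOn w v G := fun b hb => by
        by_cases h : b ∈ D
        · exact (hwD h).trans (hvu ⟨h, hb⟩).symm
        · exact if_neg h
      refine ⟨w, ?_, fun b hb => ?_, fun b hb => (hwD (.inl hb)).trans (huA hb)⟩
      · exact ((huc.congr hwD).union_of_isClosed (hvc.continuousOn.congr hwG) hDc hGc).mono hsub
      · by_cases h : b ∈ D
        · rw [hwD h]; exact hu b h
        · rcases hb with hb | hb
          · exact (h (.inl hb)).elim
          · have hbm : c b = m := by
              by_contra hne
              exact h (.inr (Finset.mem_erase.2 ⟨hne, hb⟩))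
            rw [hwG hbm.le, hbm]
            exact hv b
  obtain ⟨u, huc, hu, huA⟩ := key _ Finset.univ rfl (by simp [isLowerSet_univ])
  simp only [Finset.mem_univ, Set.ofPred_true, Set.union_univ, Set.mem_univ, true_imp_iff,
    continuousOn_univ] at huc hu
  refine ⟨⟨fun b => ⟨⟨u b, (hu b).1.1⟩, (hu b).1.2⟩, by fun_prop⟩, fun a => ?_,
    fun b p hp => (hu b).2 p hp⟩
  exact Subtype.ext (Subtype.ext ((huA a.2).trans (hu₀ a)))

end ChainLift

section SignVectors

variable {E : Type*}

lemma sle_iff {X Y : E → SignType} : sle X Y ↔ ∀ e, X e ≠ 0 → X e = Y e := by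
  refine funext_iff.trans (forall_congr' fun e => ?_)
  simp only [scomp]
  split_ifs with h <;> simp [h]

lemma scomp_eq_scomp_iff {X Y Z : E → SignType} :
    scomp X Y = scomp X Z ↔ ∀ e, X e = 0 → Y e = Z e := by
  refine funext_iff.trans (forall_congr' fun e => ?_)
  simp only [scomp]
  split_ifs with h <;> simp [h]

lemma sle_scomp (X Y : E → SignType) : sle X (scomp X Y) :=
  sle_iff.2 fun _ h => (if_neg h).symm

end SignVectors

section Topes

variable {V E : Type*} [NormedAddCommGroup V] [NormedSpace ℝ V] {f : E → (V →ᵃ[ℝ] ℝ)} {K : Set V}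

/-- The sign vector of a point. -/
noncomputable def signVec (f : E → (V →ᵃ[ℝ] ℝ)) (v : V) : E → SignType :=
  fun e => SignType.sign (f e v)

lemma mem_covs_iff {X : E → SignType} : X ∈ covs f K ↔ ∃ v ∈ K, signVec f v = X :=
  ⟨fun ⟨v, hv, hK⟩ => ⟨v, hK, funext hv⟩, fun ⟨v, hK, hv⟩ => ⟨v, fun e => congrFun hv e, hK⟩⟩

lemma signVec_mem_covs {v : V} (hv : v ∈ K) : signVec f v ∈ covs f K :=
  mem_covs_iff.2 ⟨v, hv, rfl⟩

lemma affine_lineMap_apply (g : V →ᵃ[ℝ] ℝ) (v w : V) (t : ℝ) :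
    g (AffineMap.lineMap v w t) = (1 - t) * g v + t * g w := by
  rw [AffineMap.apply_lineMap, AffineMap.lineMap_apply_ring]

open Filter Topology in
lemma scomp_mem_covs [Finite E] (hK : Convex ℝ K) {X Y : E → SignType} (hX : X ∈ covs f K)
    (hY : Y ∈ covs f K) : scomp X Y ∈ covs f K := by
  obtain ⟨v, hv, rfl⟩ := mem_covs_iff.1 hX
  obtain ⟨w, hw, rfl⟩ := mem_covs_iff.1 hY
  have h1 : ∀ᶠ t : ℝ in 𝓝[>] 0, ∀ e, signVec f (AffineMap.lineMap v w t) e =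
      scomp (signVec f v) (signVec f w) e := by
    refine eventually_all.2 fun e => ?_
    simp only [signVec, scomp, affine_lineMap_apply]
    have hcont : Tendsto (fun t : ℝ => (1 - t) * f e v + t * f e w) (𝓝[>] 0) (𝓝 (f e v)) := by
      have : Continuous fun t : ℝ => (1 - t) * f e v + t * f e w := by fun_prop
      simpa using (this.tendsto 0).mono_left nhdsWithin_le_nhds
    rcases lt_trichotomy (f e v) 0 with h | h | h
    · filter_upwards [hcont.eventually_lt_const h] with t ht
      simp [sign_neg h, sign_neg ht]
    · filter_upwards [self_mem_nhdsWithin] with t ht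
      simp [h, sign_mul, sign_pos (show 0 < t from ht)]
    · filter_upwards [hcont.eventually_const_lt h] with t ht
      simp [sign_pos h, sign_pos ht]
  have h2 : ∀ᶠ t : ℝ in 𝓝[>] 0, t < 1 :=
    nhdsWithin_le_nhds (eventually_lt_nhds one_pos)
  obtain ⟨t, h1, h2, h0⟩ := (h1.and (h2.and self_mem_nhdsWithin)).exists
  exact mem_covs_iff.2 ⟨_, hK.lineMap_mem hv hw ⟨le_of_lt h0, h2.le⟩, funext h1⟩

lemma IsTope.eq_zero [Finite E] (hK : Convex ℝ K) {T Y : E → SignType} (hT : IsTope f K T)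
    (hY : Y ∈ covs f K) {e : E} (he : T e = 0) : Y e = 0 := by
  have := congrFun (hT.2 _ (scomp_mem_covs hK hT.1 hY) (sle_scomp T Y)) e
  simpa [scomp, he] using this

lemma IsTope.scomp [Finite E] (hK : Convex ℝ K) {X T : E → SignType} (hX : X ∈ covs f K)
    (hT : IsTope f K T) : IsTope f K (scomp X T) := by
  refine ⟨scomp_mem_covs hK hX hT.1, fun Y hY h => funext fun e => ?_⟩
  by_cases he : _root_.scomp X T e = 0
  · rw [he]
    refine hT.eq_zero hK hY ?_
    by_cases hXe : X e = 0
    · simpa [_root_.scomp, hXe] using he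
    · simp [_root_.scomp, hXe] at he
  · exact (sle_iff.1 h e he).symm

lemma scomp_eq_of_ZRel [Finite E] (hK : Convex ℝ K) {p q : ZPre f K} (h : ZRel f K p q) :
    scomp (signVec f p.1) p.2.1 = scomp (signVec f p.1) q.2.1 := by
  refine scomp_eq_scomp_iff.2 fun e he => ?_
  have h1 : e ∉ SepSet p.2.1 q.2.1 := fun h' => h.2 e h' (sign_eq_zero_iff.1 he)
  have h2 := @IsTope.eq_zero _ _ _ _ f K _ hK _ _ p.2.2 q.2.2.1 e
  have h3 := @IsTope.eq_zero _ _ _ _ f K _ hK _ _ q.2.2 p.2.2.1 e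
  revert h1 h2 h3
  simp only [SepSet, Set.mem_ofPred_eq]
  generalize p.2.1 e = a
  generalize q.2.1 e = b
  revert a b
  decide

lemma ZSpace.mk_eq {v : K} {T T' : Topes f K}
    (h : scomp (signVec f v) T.1 = scomp (signVec f v) T'.1) :
    (Quot.mk _ (v, T) : ZSpace f K) = Quot.mk _ (v, T') := by
  refine Quot.sound ⟨rfl, fun e he h0 => ?_⟩
  have h1 := scomp_eq_scomp_iff.1 h e (sign_eq_zero_iff.2 h0)
  rcases he with ⟨h2, h3⟩ | ⟨h2, h3⟩ <;> rw [h2, h3] at h1 <;> simp at h1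

end Topes

namespace ZSpace

variable {V E : Type} [NormedAddCommGroup V] [NormedSpace ℝ V]
  {f : E → (V →ᵃ[ℝ] ℝ)} {K : Set V}

/-- The projection `Z(A,K) → K`. -/
def base (z : ZSpace f K) : K := Quot.lift (fun p => p.1) (fun _ _ h => Subtype.ext h.1) z

lemma continuous_base : Continuous (base : ZSpace f K → K) :=
  continuous_quot_lift _ continuous_fst

/-- The map `Z(A,K) → Sal(A,K)` recording the stratum of a point. -/
noncomputable def stratum [Finite E] (hK : Convex ℝ K) (z : ZSpace f K) : SalP f K :=
  Quot.lift (fun p : ZPre f K => (⟨signVec f p.1, scomp (signVec f p.1) p.2.1,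
      signVec_mem_covs p.1.2, p.2.2.scomp hK (signVec_mem_covs p.1.2), sle_scomp _ _⟩ : SalP f K))
    (fun p q h => by
      have h1 := scomp_eq_of_ZRel hK h
      have h2 : (p.1 : V) = q.1 := h.1
      ext1
      · simp only [h2]
      · simp only [h1]
        rw [h2]) z

lemma stratum_X [Finite E] (hK : Convex ℝ K) (z : ZSpace f K) :
    (stratum hK z).X = signVec f (base z : V) := by
  induction z using Quot.ind; rfl

lemma isOpen_le_stratum [Finite E] [FiniteDimensional ℝ V] (hK : Convex ℝ K) (p : SalP f K) :
    IsOpen {z | p ≤ stratum hK z} := by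
  have hc (e : E) : Continuous fun x : ZPre f K => f e x.1 :=
    (AffineMap.continuous_of_finiteDimensional (f e)).comp
      (continuous_subtype_val.comp continuous_fst)
  have h : Quot.mk (ZRel f K) ⁻¹' {z : ZSpace f K | p ≤ stratum hK z} =
      ⋂ e, {x | p.X e ≠ 0 → p.X e = SignType.sign (f e x.1)} ∩
        {x | f e x.1 ≠ 0 ∨ p.T e = x.2.1 e} := by
    ext x
    change sle p.X (signVec f x.1) ∧ scomp (signVec f x.1) p.T =
      scomp (signVec f x.1) x.2.1 ↔ _
    rw [sle_iff, scomp_eq_scomp_iff, ← forall_and]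
    simp [signVec, or_iff_not_imp_left]
  refine isOpen_coinduced.2 (h ▸ isOpen_iInter_of_finite fun e => .inter ?_ (.union ?_ ?_))
  · generalize p.X e = s
    cases s
    · simp
    · convert isOpen_lt (hc e) (continuous_const (y := (0 : ℝ))) using 3
      simp [eq_comm (a := (-1 : SignType)), sign_eq_neg_one_iff]
    · convert isOpen_lt (continuous_const (y := (0 : ℝ))) (hc e) using 3
      simp [eq_comm (a := (1 : SignType)), sign_eq_one_iff]
  · exact isOpen_ne_fun (hc e) continuous_const
  · exact (isOpen_discrete {T : Topes f K | p.T e = T.1 e}).preimage continuous_snd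

end ZSpace

namespace SalP

variable {V E : Type} [NormedAddCommGroup V] [NormedSpace ℝ V]
  {f : E → (V →ᵃ[ℝ] ℝ)} {K : Set V}

instance [Finite E] : Finite (SalP f K) :=
  Finite.of_injective (fun p => (p.X, p.T)) fun _ _ h =>
    SalP.ext (congrArg Prod.fst h) (congrArg Prod.snd h)

/-- A chosen point of `K` in the face indexing an element of the Salvetti poset. -/
noncomputable def center (p : SalP f K) : V := (mem_covs_iff.1 p.memX).choose

lemma center_mem (p : SalP f K) : p.center ∈ K := (mem_covs_iff.1 p.memX).choose_spec.1

lemma signVec_center (p : SalP f K) : signVec f p.center = p.X :=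
  (mem_covs_iff.1 p.memX).choose_spec.2

variable [Fintype (SalP f K)]

/-- The points of `K` lying in the open star of every face in the support of `x`. -/
def star (x : chainComplex (SalP f K)) : Set V :=
  {v | v ∈ K ∧ ∀ p, x.1 p ≠ 0 → sle p.X (signVec f v)}

lemma convex_star (hK : Convex ℝ K) (x : chainComplex (SalP f K)) : Convex ℝ (star x) := by
  have : star x = K ∩ ⋂ (p) (_ : x.1 p ≠ 0) (e) (_ : p.X e ≠ 0),
      {v | SignType.sign (f e v) = p.X e} := by
    ext v
    simp [star, sle_iff, signVec, eq_comm]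
  rw [this]
  refine hK.inter (convex_iInter fun p => convex_iInter fun _ => convex_iInter fun e =>
    convex_iInter fun he => ?_)
  generalize p.X e = s at he
  cases s
  · exact (he rfl).elim
  · exact (congrArg (Convex ℝ) (Set.ext fun v => sign_eq_neg_one_iff)).mpr
      ((convex_Iio (0 : ℝ)).affine_preimage (f e))
  · exact (congrArg (Convex ℝ) (Set.ext fun v => sign_eq_one_iff)).mpr
      ((convex_Ioi (0 : ℝ)).affine_preimage (f e))

/-- The point of `V` with barycentric coordinates `x` in terms of the centers. -/
noncomputable def bary (x : chainComplex (SalP f K)) : V := ∑ p, x.1 p • p.center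

lemma continuous_bary : Continuous (bary : chainComplex (SalP f K) → V) := by
  refine continuous_finsetSum _ fun p _ => Continuous.smul ?_ continuous_const
  exact (continuous_apply p).comp (continuous_subtype_val.comp continuous_subtype_val)

lemma apply_bary (g : V →ᵃ[ℝ] ℝ) (x : chainComplex (SalP f K)) :
    g (bary x) = ∑ p, x.1 p * g p.center := by
  have h1 (v : V) : g v = g.linear v + g 0 := by
    simpa using g.map_vadd 0 v
  simp only [bary]
  rw [h1, map_sum]
  simp only [h1 (center _), mul_add, Finset.sum_add_distrib, ← Finset.sum_mul, map_smul,
    smul_eq_mul]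
  rw [show ∑ p, x.1 p = 1 from x.1.2.2, one_mul]

lemma bary_mem_star (hK : Convex ℝ K) (x : chainComplex (SalP f K)) : bary x ∈ star x := by
  refine ⟨hK.sum_mem (fun p _ => x.1.2.1 p) x.1.2.2 fun p _ => p.center_mem, fun p hp => ?_⟩
  refine sle_iff.2 fun e he => ?_
  have hpos : 0 < x.1 p := lt_of_le_of_ne (x.1.2.1 p) hp.symm
  have hsign (q) (hq : x.1 q ≠ 0) : SignType.sign (f e q.center) = p.X e ∨
      f e q.center = 0 := by
    rw [← sign_eq_zero_iff]
    change signVec f q.center e = _ ∨ signVec f q.center e = _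
    rw [signVec_center]
    rcases x.2 p q hp hq with h | h
    · exact .inl (sle_iff.1 h.1 e he).symm
    · by_cases h0 : q.X e = 0
      · exact .inr h0
      · exact .inl (sle_iff.1 h.1 e h0)
  have hsp : SignType.sign (f e p.center) = p.X e := congrFun p.signVec_center e
  change p.X e = SignType.sign (f e (bary x))
  rw [apply_bary]
  revert hsign hsp he
  generalize p.X e = s
  intro he hsign hsp
  cases s
  · exact (he rfl).elim
  · refine (sign_neg ?_).symm
    refine Finset.sum_neg' (fun q _ => ?_) ⟨p, Finset.mem_univ _, ?_⟩
    · by_cases hq : x.1 q = 0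
      · simp [hq]
      · refine mul_nonpos_of_nonneg_of_nonpos (x.1.2.1 q) ?_
        rcases hsign q hq with h | h
        exacts [(sign_eq_neg_one_iff.1 h).le, h.le]
    · exact mul_neg_of_pos_of_neg hpos (sign_eq_neg_one_iff.1 hsp)
  · refine (sign_pos ?_).symm
    refine Finset.sum_pos' (fun q _ => ?_) ⟨p, Finset.mem_univ _, ?_⟩
    · by_cases hq : x.1 q = 0
      · simp [hq]
      · refine mul_nonneg (x.1.2.1 q) ?_
        rcases hsign q hq with h | h
        exacts [(sign_eq_one_iff.1 h).le, h.ge]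
    · exact mul_pos hpos (sign_eq_one_iff.1 hsp)

/-- The point of `Z(A,K)` over `v`, in the sheet of any tope occurring in the support of `x`. -/
noncomputable def lift (x : chainComplex (SalP f K)) (v : K) : ZSpace f K :=
  Quot.mk _ (v, ⟨_, (stdSimplex.exists_ne_zero x.1).choose.topeT⟩)

lemma lift_eq {x : chainComplex (SalP f K)} {v : K} (hv : (v : V) ∈ star x) {p : SalP f K}
    (hp : x.1 p ≠ 0) : lift x v = Quot.mk _ (v, ⟨p.T, p.topeT⟩) := by
  have key {p q : SalP f K} (h : p ≤ q) (hq : sle q.X (signVec f v)) :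
      scomp (signVec f v) p.T = scomp (signVec f v) q.T := by
    refine scomp_eq_scomp_iff.2 fun e he => ?_
    rw [← h.2]
    have : q.X e = 0 := by_contra fun h' => h' ((sle_iff.1 hq e h').trans he)
    simp [scomp, this]
  have hq := (stdSimplex.exists_ne_zero x.1).choose_spec
  refine ZSpace.mk_eq ?_
  rcases x.2 _ _ hq hp with h | h
  · exact key h (hv.2 _ hp)
  · exact (key h (hv.2 _ hq)).symm

lemma continuous_lift {B : Type*} [TopologicalSpace B] {ξ : B → chainComplex (SalP f K)}
    (hξ : Continuous ξ) {ν : B → K} (hν : Continuous ν) (h : ∀ b, (ν b : V) ∈ star (ξ b)) :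
    Continuous fun b => lift (ξ b) (ν b) := by
  refine continuous_iff_continuousAt.2 fun b₀ => ?_
  obtain ⟨p, hp⟩ := stdSimplex.exists_ne_zero (ξ b₀).1
  have hopen : IsOpen {b | (ξ b).1 p ≠ 0} :=
    isOpen_ne_fun ((continuous_apply p).comp (continuous_subtype_val.comp
      (continuous_subtype_val.comp hξ))) continuous_const
  have hc : Continuous fun b => (Quot.mk _ (ν b, ⟨p.T, p.topeT⟩) : ZSpace f K) :=
    continuous_quot_mk.comp (hν.prodMk continuous_const)
  refine hc.continuousAt.congr ?_
  filter_upwards [hopen.mem_nhds hp] with b hb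
  exact (lift_eq (h b) hb).symm

lemma le_stratum_lift [Finite E] (hK : Convex ℝ K) {x : chainComplex (SalP f K)} {v : K}
    (hv : (v : V) ∈ star x) {p : SalP f K} (hp : x.1 p ≠ 0) :
    p ≤ (lift x v).stratum hK := by
  rw [lift_eq hv hp]
  exact ⟨hv.2 p hp, rfl⟩

lemma base_mem_star [Finite E] (hK : Convex ℝ K) {x : chainComplex (SalP f K)} {z : ZSpace f K}
    (h : ∀ p, x.1 p ≠ 0 → p ≤ z.stratum hK) : (z.base : V) ∈ star x :=
  ⟨z.base.2, fun p hp => z.stratum_X hK ▸ (h p hp).1⟩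

lemma lift_base [Finite E] (hK : Convex ℝ K) {x : chainComplex (SalP f K)} {z : ZSpace f K}
    (h : ∀ p, x.1 p ≠ 0 → p ≤ z.stratum hK) : lift x z.base = z := by
  obtain ⟨p, hp⟩ := stdSimplex.exists_ne_zero x.1
  rw [lift_eq (base_mem_star hK h) hp]
  have := (h p hp).2
  revert this
  refine Quot.inductionOn z fun y hy => ZSpace.mk_eq hy

/-- The map from the chain complex of the Salvetti poset to `Z(A,K)`. -/
noncomputable def toZSpace (hK : Convex ℝ K) : C(chainComplex (SalP f K), ZSpace f K) where
  toFun x := lift x ⟨bary x, (bary_mem_star hK x).1⟩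
  continuous_toFun := continuous_lift continuous_id (continuous_bary.subtype_mk _)
    (bary_mem_star hK)

theorem isWeakHomotopyEquiv_toZSpace [Finite E] [FiniteDimensional ℝ V] (hK : Convex ℝ K) :
    IsWeakHomotopyEquiv (toZSpace hK : C(chainComplex (SalP f K), ZSpace f K)) := by
  refine .of_lifting _ fun B _ _ A hA φ ψ h => ?_
  obtain ⟨Ψ, hΨ, hle⟩ := exists_chainComplex_lift (fun b => (φ b).stratum hK)
    (fun p => (ZSpace.isOpen_le_stratum hK p).preimage φ.continuous) hA ψ
    (fun a p hp => h a ▸ le_stratum_lift hK (bary_mem_star hK _) hp)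
  have hmem (t : unitInterval) (b : B) :
      AffineMap.lineMap (bary (Ψ b)) ((φ b).base : V) (t : ℝ) ∈ star (Ψ b) :=
    (convex_star hK _).lineMap_mem (bary_mem_star hK _) (base_mem_star hK (hle b)) t.2
  let H : C(unitInterval × B, ZSpace f K) :=
    { toFun := fun x => lift (Ψ x.2) ⟨_, (hmem x.1 x.2).1⟩
      continuous_toFun := by
        refine continuous_lift (by fun_prop) (Continuous.subtype_mk ?_ _) fun x => hmem x.1 x.2
        simp only [AffineMap.lineMap_apply_module]
        have h1 : Continuous fun x : unitInterval × B => bary (Ψ x.2) :=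
          continuous_bary.comp (by fun_prop)
        have h2 : Continuous fun x : unitInterval × B => ((φ x.2).base : V) :=
          continuous_subtype_val.comp (ZSpace.continuous_base.comp (by fun_prop))
        fun_prop }
  refine ⟨Ψ, hΨ, ⟨⟨⟨H, fun b => ?_, fun b => ?_⟩, fun t b hb => ?_⟩⟩⟩
  · simp [H, toZSpace]
  · simpa [H] using lift_base hK (hle b)
  · have hb' : ((φ b).base : V) = bary (Ψ b) := by
      rw [← h ⟨b, hb⟩, hΨ ⟨b, hb⟩]
      rfl
    simp [H, toZSpace, hb']

end SalP

/-- The Salvetti complex `|Sal(A,K)|` is weakly homotopy equivalent to the space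
`Z(A,K)`: there is a space admitting weak homotopy equivalences to both. -/
theorem salvetti_complex_weakEquiv_ZSpace
    {V E : Type} [NormedAddCommGroup V] [NormedSpace ℝ V] [FiniteDimensional ℝ V]
    [Fintype E]
    (f : E → (V →ᵃ[ℝ] ℝ)) (hf : ∀ e, (f e).linear ≠ 0)
    (K : Set V) (hKne : K.Nonempty) (hKconv : Convex ℝ K) (hKopen : IsOpen K) :
    ∃ (W : Type) (_ : TopologicalSpace W)
      (g : C(W, ↥(orderComplex (SalP f K)))) (h : C(W, ZSpace f K)),
      IsWeakHomotopyEquiv g ∧ IsWeakHomotopyEquiv h := by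
  let _ : Fintype (SalP f K) := Fintype.ofFinite _
  obtain ⟨e⟩ := chainComplex.exists_homeomorph (SalP f K)
  exact ⟨chainComplex (SalP f K), inferInstance, e, SalP.toZSpace hKconv,
    .of_homeomorph e, SalP.isWeakHomotopyEquiv_toZSpace hKconv⟩
end

section
/- For any finite collection A of cooriented affine hyperplanes in V indexed by E and any nonempty convex open K ⊆ V, the set L(A,K) = {X ∈ {-,0,+}^E : F_X ∩ K ≠ ∅} is a conditional oriented matroid: it is nonempty, closed under the operation (X,Y) ↦ X∘(−Y), and for all X, Y ∈ L(A,K) and e ∈ Sep(X,Y) there exists Z ∈ L(A,K) with Z_e = 0 and Z_f = (X∘Y)_f for all f ∈ E ∖ Sep(X,Y). -/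
/-- `L` is a conditional oriented matroid: it is nonempty, closed under composition with
negation, and satisfies the elimination axiom. -/
def IsCOM {E : Type*} (L : Set (E → SignType)) : Prop :=
  L.Nonempty ∧
    (∀ X ∈ L, ∀ Y ∈ L, scomp X (-Y) ∈ L) ∧
    (∀ X ∈ L, ∀ Y ∈ L, ∀ e ∈ SepSet X Y,
      ∃ Z ∈ L, Z e = 0 ∧ ∀ f ∉ SepSet X Y, Z f = scomp X Y f)

/-- `L` is an oriented matroid: a conditional oriented matroid containing the zero
sign vector. -/
def IsOM {E : Type*} (L : Set (E → SignType)) : Prop :=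
  IsCOM L ∧ (0 : E → SignType) ∈ L

/-- The value of `f` at the point `AffineMap.lineMap x y t`. -/
theorem AffineMap.apply_lineMap_real {W : Type*} [AddCommGroup W] [Module ℝ W]
    (f : W →ᵃ[ℝ] ℝ) (x y : W) (t : ℝ) :
    f (AffineMap.lineMap x y t) = (1 - t) * f x + t * f y := by
  rw [AffineMap.apply_lineMap, AffineMap.lineMap_apply]
  simp only [vsub_eq_sub, smul_eq_mul, vadd_eq_add]
  ring

/-- A sufficiently short step from `a` away from `b` has the sign of `a`, or that of `-b` if
`a = 0`. -/
theorem eventually_sign_sub_mul (a b : ℝ) :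
    ∀ᶠ t : ℝ in nhdsWithin 0 (Set.Ioi 0), SignType.sign ((1 - -t) * a + -t * b) =
      if SignType.sign a = 0 then -SignType.sign b else SignType.sign a := by
  rcases eq_or_ne a 0 with rfl | ha
  · filter_upwards [self_mem_nhdsWithin] with t ht
    simp [Left.sign_neg, sign_mul, sign_pos (Set.mem_Ioi.mp ht)]
  · have hc : Filter.Tendsto (fun t : ℝ => (1 - -t) * a + -t * b)
        (nhdsWithin 0 (Set.Ioi 0)) (nhds a) := by
      have h : Continuous fun t : ℝ => (1 - -t) * a + -t * b := by fun_prop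
      simpa using (h.tendsto 0).mono_left nhdsWithin_le_nhds
    rw [if_neg (sign_ne_zero.mpr ha)]
    rcases lt_or_gt_of_ne ha with h | h
    · filter_upwards [hc.eventually_lt_const h] with t ht
      rw [sign_neg ht, sign_neg h]
    · filter_upwards [hc.eventually_const_lt h] with t ht
      rw [sign_pos ht, sign_pos h]

/-- A strictly convex combination of two reals that do not have opposite signs has the sign of
the first, or that of the second if the first is zero. -/
theorem sign_convex_combination {a b t : ℝ} (ht₀ : 0 < t) (ht₁ : t < 1)
    (h : ¬((SignType.sign a = 1 ∧ SignType.sign b = -1) ∨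
      (SignType.sign a = -1 ∧ SignType.sign b = 1))) :
    SignType.sign ((1 - t) * a + t * b) =
      if SignType.sign a = 0 then SignType.sign b else SignType.sign a := by
  have ht₁' : 0 < 1 - t := sub_pos.mpr ht₁
  simp only [sign_eq_one_iff, sign_eq_neg_one_iff, not_or, not_and, not_lt] at h
  rcases lt_trichotomy a 0 with ha | rfl | ha
  · have : (1 - t) * a + t * b < 0 := by
      nlinarith [mul_neg_of_pos_of_neg ht₁' ha, mul_nonpos_of_nonneg_of_nonpos ht₀.le (h.2 ha)]
    simp [sign_neg this, sign_neg ha]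
  · simp [sign_mul, sign_pos ht₀]
  · have : 0 < (1 - t) * a + t * b := by
      nlinarith [mul_pos ht₁' ha, mul_nonneg ht₀.le (h.1 ha)]
    simp [sign_pos this, sign_pos ha]

/-- Two reals of opposite signs have a strictly convex combination equal to zero. -/
theorem exists_convex_combination_eq_zero {a b : ℝ}
    (h : (SignType.sign a = 1 ∧ SignType.sign b = -1) ∨
      (SignType.sign a = -1 ∧ SignType.sign b = 1)) :
    ∃ t : ℝ, 0 < t ∧ t < 1 ∧ (1 - t) * a + t * b = 0 := by
  simp only [sign_eq_one_iff, sign_eq_neg_one_iff] at h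
  have hab : a - b ≠ 0 := by rcases h with h | h <;> intro h' <;> linarith
  refine ⟨a / (a - b), ?_, ?_, by field_simp; ring⟩
  · rcases h with ⟨ha, hb⟩ | ⟨ha, hb⟩
    · exact div_pos ha (by linarith)
    · exact div_pos_of_neg_of_neg ha (by linarith)
  · rcases h with ⟨ha, hb⟩ | ⟨ha, hb⟩
    · rw [div_lt_one (by linarith)]; linarith
    · rw [div_lt_one_of_neg (by linarith)]; linarith

variable {V : Type*} [NormedAddCommGroup V] [NormedSpace ℝ V] [FiniteDimensional ℝ V]
variable {E : Type*} [Fintype E]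

/-- For any finite collection `A` of cooriented affine hyperplanes in `V` indexed by `E`
and any nonempty convex open `K ⊆ V`, the set `L(A,K)` is a conditional oriented
matroid. -/
theorem covs_isCOM
    (f : E → (V →ᵃ[ℝ] ℝ)) (hf : ∀ e, (f e).linear ≠ 0)
    (K : Set V) (hKne : K.Nonempty) (hKconv : Convex ℝ K) (hKopen : IsOpen K) :
    IsCOM (covs f K) := by
  refine ⟨?_, ?_, ?_⟩
  · obtain ⟨v, hv⟩ := hKne
    exact ⟨fun e => SignType.sign (f e v), v, fun _ => rfl, hv⟩
  · rintro X ⟨x, hxX, hxK⟩ Y ⟨y, hyY, -⟩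
    have hK : ∀ᶠ t : ℝ in nhdsWithin 0 (Set.Ioi 0), AffineMap.lineMap x y (-t) ∈ K := by
      have hc : Continuous fun t : ℝ => (AffineMap.lineMap x y (-t) : V) :=
        AffineMap.lineMap_continuous.comp continuous_neg
      refine ((hc.tendsto 0).mono_left nhdsWithin_le_nhds).eventually (hKopen.mem_nhds ?_)
      simpa using hxK
    have hs := Filter.eventually_all.mpr fun e => eventually_sign_sub_mul (f e x) (f e y)
    obtain ⟨t, htK, ht⟩ := (hK.and hs).exists
    refine ⟨AffineMap.lineMap x y (-t), fun e => ?_, htK⟩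
    rw [AffineMap.apply_lineMap_real, ht e, hxX e, hyY e]
    rfl
  · rintro X ⟨x, hxX, hxK⟩ Y ⟨y, hyY, hyK⟩ e he
    obtain rfl : (fun e => SignType.sign (f e x)) = X := funext hxX
    obtain rfl : (fun e => SignType.sign (f e y)) = Y := funext hyY
    obtain ⟨t, ht₀, ht₁, ht⟩ := exists_convex_combination_eq_zero he
    refine ⟨fun e => SignType.sign (f e (AffineMap.lineMap x y t)), ⟨_, fun _ => rfl,
      hKconv.lineMap_mem hxK hyK ⟨ht₀.le, ht₁.le⟩⟩, ?_, fun g hg => ?_⟩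
    · simp only [AffineMap.apply_lineMap_real, ht, sign_zero]
    · simp only [AffineMap.apply_lineMap_real]
      exact sign_convex_combination ht₀ ht₁ hg
end

section
/- L(A,K) is an oriented matroid (i.e. contains the zero sign vector) if and only if there exists a point of K contained in all of the hyperplanes H_e, and in that case L(A,K) = L(A,V). -/
section Geometry

variable {E : Type*} {V : Type*} [NormedAddCommGroup V] [NormedSpace ℝ V]

/-- Moving slightly from a point `x` of an open set `K` towards a point `y` realizes the
composition of the sign vectors of `x` and `y` inside `K`. -/
theorem scomp_mem_covs_s13 [Finite E] {f : E → (V →ᵃ[ℝ] ℝ)} {K : Set V} (hK : IsOpen K) {x : V}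
    (hx : x ∈ K) (y : V) :
    scomp (fun e => SignType.sign (f e x)) (fun e => SignType.sign (f e y)) ∈ covs f K := by
  have hev : ∀ᶠ t : ℝ in nhdsWithin 0 (Set.Ioi 0), AffineMap.lineMap x y t ∈ K ∧
      ∀ e, f e x ≠ 0 →
        SignType.sign (f e (AffineMap.lineMap x y t)) = SignType.sign (f e x) := by
    refine Filter.Eventually.filter_mono nhdsWithin_le_nhds (Filter.Eventually.and ?_ ?_)
    · refine (AffineMap.lineMap_continuous (R := ℝ)).continuousAt.eventually_mem ?_
      simpa using hK.mem_nhds hx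
    · refine Filter.eventually_all.2 fun e => ?_
      by_cases he : f e x = 0
      · simp [he]
      have hc : ContinuousAt
          (fun t : ℝ => AffineMap.lineMap (k := ℝ) (f e x) (f e y) t) 0 :=
        AffineMap.lineMap_continuous.continuousAt
      rcases lt_or_gt_of_ne he with h | h
      · filter_upwards [hc.eventually_lt_const (by simpa using h)] with t ht _
        rw [AffineMap.apply_lineMap, sign_neg ht, sign_neg h]
      · filter_upwards [hc.eventually_const_lt (by simpa using h)] with t ht _
        rw [AffineMap.apply_lineMap, sign_pos ht, sign_pos h]
  obtain ⟨t, ⟨htK, ht⟩, ht0⟩ := (hev.and self_mem_nhdsWithin).exists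
  refine ⟨AffineMap.lineMap x y t, fun e => ?_, htK⟩
  by_cases he : f e x = 0
  · rw [AffineMap.apply_lineMap]
    simp [scomp, he, AffineMap.lineMap_apply, sign_mul, sign_pos (show 0 < t from ht0)]
  · rw [ht e he]
    simp [scomp, he]

/-- If an affine function `g` takes opposite nonzero signs at `x` and `y`, then it vanishes at an
interior point of the segment from `x` to `y`. -/
theorem AffineMap.exists_lineMap_eq_zero_of_mul_neg (g : V →ᵃ[ℝ] ℝ) {x y : V}
    (h : g x * g y < 0) :
    ∃ t : ℝ, 0 < t ∧ t < 1 ∧ g (AffineMap.lineMap x y t) = 0 := by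
  simp only [AffineMap.apply_lineMap, AffineMap.lineMap_apply_ring]
  rcases mul_neg_iff.1 h with ⟨h1, h2⟩ | ⟨h1, h2⟩
  · have hd : 0 < g x - g y := by linarith
    refine ⟨g x / (g x - g y), by positivity, (div_lt_one hd).2 (by linarith), ?_⟩
    field_simp
    ring
  · have hd : 0 < g y - g x := by linarith
    refine ⟨-g x / (g y - g x), div_pos (by linarith) hd,
      (div_lt_one hd).2 (by linarith), ?_⟩
    field_simp
    ring

/-- Where `x` and `y` do not have opposite nonzero signs, an interior point of the segment from
`x` to `y` has the composed sign. -/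
theorem sign_lineMap_of_notMem_sepSet {f : E → (V →ᵃ[ℝ] ℝ)} {x y : V} {e : E}
    (he : e ∉ SepSet (fun e => SignType.sign (f e x)) (fun e => SignType.sign (f e y)))
    {t : ℝ} (ht0 : 0 < t) (ht1 : t < 1) :
    SignType.sign (f e (AffineMap.lineMap x y t)) =
      scomp (fun e => SignType.sign (f e x)) (fun e => SignType.sign (f e y)) e := by
  simp only [SepSet, Set.mem_ofPred_eq, sign_eq_one_iff, sign_eq_neg_one_iff, not_or, not_and,
    not_lt] at he
  rw [AffineMap.apply_lineMap, AffineMap.lineMap_apply_ring]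
  have ht1' : 0 < 1 - t := by linarith
  rcases lt_trichotomy (f e x) 0 with h | h | h
  · have := he.2 h
    simp only [scomp, sign_eq_zero_iff, h.ne, if_false]
    rw [sign_neg h, sign_neg (by nlinarith)]
  · simp [scomp, h, sign_mul, sign_pos ht0]
  · have := he.1 h
    simp only [scomp, sign_eq_zero_iff, h.ne', if_false]
    rw [sign_pos h, sign_pos (by nlinarith)]

/-- The covectors of an arrangement of affine hyperplanes restricted to a nonempty convex open
set form a conditional oriented matroid. -/
theorem isCOM_covs [Finite E] (f : E → (V →ᵃ[ℝ] ℝ)) {K : Set V} (hKne : K.Nonempty)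
    (hKconv : Convex ℝ K) (hKopen : IsOpen K) : IsCOM (covs f K) := by
  refine ⟨?_, ?_, ?_⟩
  · obtain ⟨x, hx⟩ := hKne
    exact ⟨fun e => SignType.sign (f e x), x, fun _ => rfl, hx⟩
  · rintro X ⟨x, hX, hx⟩ Y ⟨y, hY, -⟩
    obtain rfl : (fun e => SignType.sign (f e x)) = X := funext hX
    obtain rfl : (fun e => SignType.sign (f e y)) = Y := funext hY
    convert scomp_mem_covs_s13 (f := f) hKopen hx (AffineMap.lineMap x y (-1 : ℝ)) using 1
    funext e
    by_cases he : f e x = 0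
    · simp [scomp, he, AffineMap.apply_lineMap, AffineMap.lineMap_apply_ring, Left.sign_neg]
    · simp [scomp, he]
  · rintro X ⟨x, hX, hx⟩ Y ⟨y, hY, hy⟩ e he
    obtain rfl : (fun e => SignType.sign (f e x)) = X := funext hX
    obtain rfl : (fun e => SignType.sign (f e y)) = Y := funext hY
    have hmul : f e x * f e y < 0 := by
      simp only [SepSet, Set.mem_ofPred_eq, sign_eq_one_iff, sign_eq_neg_one_iff] at he
      exact mul_neg_iff.2 he
    obtain ⟨t, ht0, ht1, ht⟩ := (f e).exists_lineMap_eq_zero_of_mul_neg hmul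
    exact ⟨fun e' => SignType.sign (f e' (AffineMap.lineMap x y t)),
      ⟨AffineMap.lineMap x y t, fun _ => rfl, hKconv.lineMap_mem hx hy ⟨ht0.le, ht1.le⟩⟩,
      by simp [ht], fun e' he' => sign_lineMap_of_notMem_sepSet he' ht0 ht1⟩

/-- The zero sign vector is a covector exactly when the hyperplanes have a common point in `K`. -/
theorem zero_mem_covs_iff {f : E → (V →ᵃ[ℝ] ℝ)} {K : Set V} :
    (0 : E → SignType) ∈ covs f K ↔ ∃ v ∈ K, ∀ e, f e v = 0 := by
  simp [covs, face, Set.Nonempty, and_comm]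

end Geometry

variable {V : Type*} [NormedAddCommGroup V] [NormedSpace ℝ V] [FiniteDimensional ℝ V]
variable {E : Type*} [Fintype E]

/-- `L(A,K)` is an oriented matroid (i.e. a conditional oriented matroid containing the
zero sign vector) if and only if some point of `K` lies on all the hyperplanes; in that
case `L(A,K) = L(A,V)`. -/
theorem covs_isOM_iff
    (f : E → (V →ᵃ[ℝ] ℝ)) (hf : ∀ e, (f e).linear ≠ 0)
    (K : Set V) (hKne : K.Nonempty) (hKconv : Convex ℝ K) (hKopen : IsOpen K) :
    (IsOM (covs f K) ↔ ∃ v ∈ K, ∀ e, f e v = 0) ∧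
      ((∃ v ∈ K, ∀ e, f e v = 0) → covs f K = covs f (Set.univ : Set V)) := by
  refine ⟨?_, ?_⟩
  · rw [IsOM, zero_mem_covs_iff, and_iff_right (isCOM_covs f hKne hKconv hKopen)]
  · rintro ⟨v, hv, hv0⟩
    refine Set.Subset.antisymm (fun X ⟨x, hX, _⟩ => ⟨x, hX, trivial⟩) ?_
    rintro X ⟨x, hX, -⟩
    convert scomp_mem_covs_s13 (f := f) hKopen hv x using 1
    funext e
    simp [scomp, hv0 e, hX e]
end

section
/- For covectors X, Y ∈ L(A,K), one has X ≤ Y (i.e. X∘Y = Y) if and only if the face F_X is contained in the closure of the face F_Y. -/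
variable {V : Type*} [NormedAddCommGroup V] [NormedSpace ℝ V] [FiniteDimensional ℝ V]
variable {E : Type*} [Fintype E]

/-- If `sign a` is zero or equals `sign b`, every point of the segment from `a` to `b` other than
`a` has the sign of `b`. -/
theorem sign_lineMap_eq_of_sign_eq {a b t : ℝ} (ht₀ : 0 < t) (ht₁ : t < 1)
    (h : SignType.sign a ≠ 0 → SignType.sign b = SignType.sign a) :
    SignType.sign (AffineMap.lineMap a b t) = SignType.sign b := by
  rw [AffineMap.lineMap_apply_ring]
  have hs : 0 < 1 - t := sub_pos.2 ht₁
  rcases lt_trichotomy a 0 with ha | rfl | ha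
  · have hb : b < 0 := by simpa [ha, sign_eq_neg_one_iff] using h
    rw [sign_neg hb, sign_neg]
    nlinarith [mul_pos hs (neg_pos.2 ha), mul_pos ht₀ (neg_pos.2 hb)]
  · simp [sign_mul, sign_pos ht₀]
  · have hb : 0 < b := by simpa [ha, ha.ne', sign_eq_one_iff] using h
    rw [sign_pos hb, sign_pos]
    positivity

theorem sle_iff_forall_eq {E : Type*} {X Y : E → SignType} :
    sle X Y ↔ ∀ e, X e ≠ 0 → Y e = X e := by
  simp only [sle, funext_iff, scomp]
  refine forall_congr' fun e => ?_
  split_ifs with h <;> simp [h, eq_comm]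

theorem face_subset_closure_face_of_sle {E V : Type*} [NormedAddCommGroup V] [NormedSpace ℝ V]
    {f : E → (V →ᵃ[ℝ] ℝ)} {X Y : E → SignType} (h : sle X Y) (hY : (face f Y).Nonempty) :
    face f X ⊆ closure (face f Y) := by
  intro x hx
  obtain ⟨y, hy⟩ := hY
  have h0 : (0 : ℝ) ∈ closure (Set.Ioo 0 1) := by simp [closure_Ioo]
  have hmaps : Set.MapsTo (AffineMap.lineMap x y : ℝ → V) (Set.Ioo 0 1) (face f Y) := by
    intro t ht e
    rw [AffineMap.apply_lineMap, sign_lineMap_eq_of_sign_eq ht.1 ht.2, hy e]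
    rw [hx e, hy e]
    exact sle_iff_forall_eq.1 h e
  simpa using map_mem_closure AffineMap.lineMap_continuous h0 hmaps

theorem sle_of_mem_face_of_mem_closure_face {E V : Type*} [NormedAddCommGroup V]
    [NormedSpace ℝ V] {f : E → (V →ᵃ[ℝ] ℝ)} (hf : ∀ e, Continuous (f e)) {X Y : E → SignType}
    {x : V} (hx : x ∈ face f X) (hxY : x ∈ closure (face f Y)) : sle X Y := by
  refine sle_iff_forall_eq.2 fun e he => ?_
  have hne : f e x ≠ 0 := by rwa [← hx e, ne_eq, sign_eq_zero_iff] at he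
  have hsign : ContinuousAt (fun v => SignType.sign (f e v)) x :=
    (continuousAt_sign_of_ne_zero hne).comp (hf e).continuousAt
  have hev : ∀ᶠ v in nhds x, SignType.sign (f e v) = X e :=
    hsign.eventually_mem (by simp [nhds_discrete, hx e] : {X e} ∈ nhds (SignType.sign (f e x)))
  obtain ⟨v, hvY, hv⟩ := ((mem_closure_iff_frequently.1 hxY).and_eventually hev).exists
  rw [← hvY e, hv]

/-- For covectors `X, Y ∈ L(A,K)`, one has `X ≤ Y` if and only if the face `F_X` is
contained in the closure of the face `F_Y`. -/
theorem sle_iff_face_subset_closure_face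
    (f : E → (V →ᵃ[ℝ] ℝ)) (hf : ∀ e, (f e).linear ≠ 0)
    (K : Set V) (hKne : K.Nonempty) (hKconv : Convex ℝ K) (hKopen : IsOpen K)
    (X Y : E → SignType) (hX : X ∈ covs f K) (hY : Y ∈ covs f K) :
    sle X Y ↔ face f X ⊆ closure (face f Y) := by
  obtain ⟨x, hx, -⟩ := hX
  obtain ⟨y, hy, -⟩ := hY
  exact ⟨fun h => face_subset_closure_face_of_sle h ⟨y, hy⟩, fun h =>
    sle_of_mem_face_of_mem_closure_face
      (fun e => (f e).continuous_of_finiteDimensional) hx (h hx)⟩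
end
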